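/- Square-face antipodal relation. Let d ≥ 1, let x be a (d+1)-cube ball packing in ℝ^{d+2}, let u ∈ {0,1}^{d+1} and let i ≠ j be two coordinates; let v, z, w be obtained from u by flipping coordinate i, flipping coordinate j, and flipping both coordinates i and j, respectively (so u, v, w, z are the four vertices of a square face of the cube). Then κ(x_u) + κ(x_w) = κ(x_v) + κ(x_z). -/

import Mathlib

noncomputable section

open Finset

/-- Inversive product on ℝ^{d+2}. -/
def Qd (d : ℕ) (a b : Fin (d + 2) → ℝ) : ℝ :=
  (∑ i : Fin (d + 1), a i.castSucc * b i.castSucc) -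
    a (Fin.last (d + 1)) * b (Fin.last (d + 1))

/-- Curvature of a d-ball in inversive coordinates. -/
def curvd (d : ℕ) (a : Fin (d + 2) → ℝ) : ℝ :=
  a (Fin.last (d + 1)) - a ((Fin.last d).castSucc)

/-- A (d+1)-cube ball packing, indexed by the vertices `{0,1}^{d+1}` of the (d+1)-cube
(here `Fin (d+1) → Bool`), with inversive products prescribed by Hamming distance. -/
def IsCubePacking (d : ℕ) (x : (Fin (d + 1) → Bool) → (Fin (d + 2) → ℝ)) : Prop :=
  ∀ u v, Qd d (x u) (x v) = 1 - 2 * (hammingDist u v : ℝ)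

/-- The inversive product as a bilinear form. -/
def inversiveForm (d : ℕ) : LinearMap.BilinForm ℝ (Fin (d + 2) → ℝ) :=
  LinearMap.mk₂ ℝ (Qd d)
    (fun a b c => by simp only [Qd, Pi.add_apply, add_mul, sum_add_distrib]; ring)
    (fun r a b => by simp only [Qd, Pi.smul_apply, smul_eq_mul, mul_assoc, mul_sub, mul_sum])
    (fun a b c => by simp only [Qd, Pi.add_apply, mul_add, sum_add_distrib]; ring)
    (fun r a b => by
      simp only [Qd, Pi.smul_apply, smul_eq_mul, mul_left_comm _ r, mul_sub, mul_sum])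

theorem inversiveForm_apply (d : ℕ) (a b : Fin (d + 2) → ℝ) :
    inversiveForm d a b = Qd d a b := rfl

/-- The curvature is the inversive product with a fixed light-like vector. -/
theorem inversiveForm_curvature_vector (d : ℕ) (a : Fin (d + 2) → ℝ) :
    inversiveForm d (-Pi.single (Fin.last d).castSucc 1 - Pi.single (Fin.last (d + 1)) 1) a =
      curvd d a := by
  have h (i : Fin (d + 1)) :
      (Pi.single (Fin.last d).castSucc (1 : ℝ) : Fin (d + 2) → ℝ) i.castSucc =
        if i = Fin.last d then 1 else 0 := by
    simp [Pi.single_apply]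
  simp only [inversiveForm_apply, Qd, curvd, Pi.sub_apply, Pi.neg_apply, h]
  have hcast (i : Fin (d + 1)) :
      (Pi.single (Fin.last (d + 1)) (1 : ℝ) : Fin (d + 2) → ℝ) i.castSucc = 0 :=
    Pi.single_eq_of_ne (Fin.castSucc_ne_last i) 1
  have hlast : (Pi.single (Fin.last d).castSucc (1 : ℝ) : Fin (d + 2) → ℝ) (Fin.last (d + 1)) = 0 :=
    Pi.single_eq_of_ne (Fin.castSucc_ne_last _).symm 1
  simp only [hcast, hlast, Pi.single_eq_same]
  simp
  ring

/-- Flipping one coordinate changes the Hamming distance to `y` by `1` or `-1`. -/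
theorem hammingDist_update_not {ι : Type*} [Fintype ι] [DecidableEq ι] (u y : ι → Bool) (k : ι) :
    (hammingDist (Function.update u k (!u k)) y : ℝ) =
      hammingDist u y + 1 - 2 * if u k = y k then 0 else 1 := by
  have h (a : ι → Bool) : (hammingDist a y : ℝ) =
      (∑ m ∈ univ.erase k, if a m ≠ y m then 1 else 0) + if a k ≠ y k then 1 else 0 := by
    rw [sum_erase_add _ _ (mem_univ k)]
    simp only [hammingDist, sum_boole]
  rw [h, h u, sum_congr rfl fun m hm => by
    rw [Function.update_of_ne (ne_of_mem_erase hm)], Function.update_self]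
  generalize (∑ m ∈ univ.erase k, if u m ≠ y m then (1 : ℝ) else 0) = s
  cases u k <;> cases y k <;> norm_num <;> ring

/-- The edge vectors of a cube packing at a vertex `u`, together with the centre of the cube. -/
def edgeFrame (d : ℕ) (x : (Fin (d + 1) → Bool) → (Fin (d + 2) → ℝ))
    (u : Fin (d + 1) → Bool) : Option (Fin (d + 1)) → (Fin (d + 2) → ℝ)
  | some k => x (Function.update u k (!u k)) - x u
  | none => x u + (1 / 2 : ℝ) • ∑ k, (x (Function.update u k (!u k)) - x u)

namespace IsCubePacking

variable {d : ℕ} {x : (Fin (d + 1) → Bool) → (Fin (d + 2) → ℝ)}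

theorem form_edge_vertex (hx : IsCubePacking d x) (u : Fin (d + 1) → Bool) (k : Fin (d + 1)) :
    inversiveForm d (edgeFrame d x u (some k)) (x u) = -2 := by
  simp only [edgeFrame, map_sub, LinearMap.sub_apply, inversiveForm_apply, hx _ _,
    hammingDist_update_not]
  norm_num

theorem form_vertex_edge (hx : IsCubePacking d x) (u : Fin (d + 1) → Bool) (k : Fin (d + 1)) :
    inversiveForm d (x u) (edgeFrame d x u (some k)) = -2 := by
  simp only [edgeFrame, map_sub, inversiveForm_apply, hx _ _,
    hammingDist_comm u, hammingDist_update_not]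
  norm_num

theorem form_edge_edge (hx : IsCubePacking d x) (u : Fin (d + 1) → Bool) (k l : Fin (d + 1)) :
    inversiveForm d (edgeFrame d x u (some k)) (edgeFrame d x u (some l)) =
      if k = l then 4 else 0 := by
  simp only [edgeFrame, map_sub, LinearMap.sub_apply, inversiveForm_apply, hx _ _,
    hammingDist_update_not, hammingDist_comm u, hammingDist_self]
  rcases eq_or_ne k l with rfl | h
  · simp
    norm_num
  · simp [h]
    norm_num

theorem edgeFrame_none (u : Fin (d + 1) → Bool) :
    edgeFrame d x u none = x u + (1 / 2 : ℝ) • ∑ k, edgeFrame d x u (some k) := rfl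

theorem form_center_edge (hx : IsCubePacking d x) (u : Fin (d + 1) → Bool) (k : Fin (d + 1)) :
    inversiveForm d (edgeFrame d x u none) (edgeFrame d x u (some k)) = 0 := by
  rw [edgeFrame_none]
  simp [hx.form_vertex_edge, hx.form_edge_edge, LinearMap.sum_apply]
  norm_num

theorem form_edge_center (hx : IsCubePacking d x) (u : Fin (d + 1) → Bool) (k : Fin (d + 1)) :
    inversiveForm d (edgeFrame d x u (some k)) (edgeFrame d x u none) = 0 := by
  rw [edgeFrame_none]
  simp [hx.form_edge_vertex, hx.form_edge_edge]
  norm_num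

theorem form_center_center (hx : IsCubePacking d x) (u : Fin (d + 1) → Bool) :
    inversiveForm d (edgeFrame d x u none) (edgeFrame d x u none) = -d := by
  conv_lhs => arg 2; rw [edgeFrame_none]
  rw [map_add, map_smul, map_sum, sum_eq_zero fun k _ => hx.form_center_edge u k,
    edgeFrame_none]
  simp [hx.form_edge_vertex, LinearMap.sum_apply, inversiveForm_apply d (x u), hx u u]
  ring

theorem linearIndependent_edgeFrame (hd : 1 ≤ d) (hx : IsCubePacking d x)
    (u : Fin (d + 1) → Bool) : LinearIndependent ℝ (edgeFrame d x u) := by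
  refine LinearMap.linearIndependent_of_isOrthoᵢ (B := inversiveForm d) ?_ ?_
  · rw [LinearMap.isOrthoᵢ_def]
    rintro (_ | k) (_ | l) h
    · exact absurd rfl h
    · exact hx.form_center_edge u l
    · exact hx.form_edge_center u k
    · rw [hx.form_edge_edge, if_neg fun e => h (congrArg some e)]
  · rintro (_ | k) h
    · rw [hx.form_center_center, neg_eq_zero, Nat.cast_eq_zero] at h
      omega
    · rw [hx.form_edge_edge] at h
      norm_num at h

/-- The vectors of a cube packing span the whole space. -/
theorem span_range_eq_top (hd : 1 ≤ d) (hx : IsCubePacking d x) :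
    Submodule.span ℝ (Set.range x) = ⊤ := by
  let u : Fin (d + 1) → Bool := fun _ => false
  have hmem (y) : x y ∈ Submodule.span ℝ (Set.range x) := Submodule.subset_span ⟨y, rfl⟩
  have hspan := (hx.linearIndependent_edgeFrame hd u).span_eq_top_of_card_eq_finrank (by simp)
  rw [eq_top_iff, ← hspan, Submodule.span_le]
  rintro _ ⟨_ | k, rfl⟩
  · exact add_mem (hmem u) (Submodule.smul_mem _ _
      (sum_mem fun k _ => sub_mem (hmem _) (hmem u)))
  · exact sub_mem (hmem _) (hmem u)

end IsCubePacking

/-- Square-face antipodal relation: for the four vertices `u, v, z, w` of a square face of the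
(d+1)-cube (where `v`, `z` flip one coordinate of `u` and `w` flips both), the curvatures
satisfy `κ(x_u) + κ(x_w) = κ(x_v) + κ(x_z)`. -/
theorem square_face_antipodal (d : ℕ) (hd : 1 ≤ d)
    (x : (Fin (d + 1) → Bool) → (Fin (d + 2) → ℝ)) (hx : IsCubePacking d x)
    (u : Fin (d + 1) → Bool) (i j : Fin (d + 1)) (hij : i ≠ j)
    (v z w : Fin (d + 1) → Bool)
    (hv : v = Function.update u i (!u i))
    (hz : z = Function.update u j (!u j))
    (hw : w = Function.update (Function.update u i (!u i)) j (!u j)) :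
    curvd d (x u) + curvd d (x w) = curvd d (x v) + curvd d (x z) := by
  have hker : Submodule.span ℝ (Set.range x) ≤
      LinearMap.ker (LinearMap.flip (inversiveForm d) (x u + x w - x v - x z)) := by
    rw [Submodule.span_le]
    rintro _ ⟨y, rfl⟩
    have hxy (a) : inversiveForm d (x y) (x a) = 1 - 2 * (hammingDist a y : ℝ) := by
      rw [inversiveForm_apply, hx, hammingDist_comm]
    simp only [SetLike.mem_coe, LinearMap.mem_ker, LinearMap.flip_apply (inversiveForm d),
      map_add (inversiveForm d _), map_sub (inversiveForm d _), hxy]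
    have hwv : w = Function.update v j (!v j) := by
      rw [hw, hv, Function.update_of_ne hij.symm]
    have hvj : v j = u j := by rw [hv, Function.update_of_ne hij.symm]
    rw [hwv, hammingDist_update_not, hvj, hz, hammingDist_update_not]
    ring
  rw [hx.span_range_eq_top hd] at hker
  have h := inversiveForm_curvature_vector d (x u + x w - x v - x z)
  rw [← LinearMap.flip_apply, LinearMap.mem_ker.mp (hker Submodule.mem_top)] at h
  simp only [curvd, Pi.add_apply, Pi.sub_apply] at h ⊢
  linarith
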